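/- arXiv:1307.3582 — 3 statements merged into one kernel-verified Lean document; each statement's English description precedes it below -/
import Mathlib

section
/- Let 0 < γ ≤ 1 and let E ⊆ [n]² with |E| ≥ γ·n². Then a uniformly random permutation π of [n] satisfies P[ g_E(π) ≤ γn/10 ] < 2·e^{−γ²n/20}. Equivalently, the number of permutations π of [n] with g_E(π) ≤ γn/10 is less than 2·n!·e^{−γ²n/20}. -/
open Finset
open scoped Classical

noncomputable section

/-- For `E ⊆ [n]²` and a permutation `π` of `[n]`,
`g_E(π) = |{i ∈ [n] : (i, π(i)) ∈ E}|`. -/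
def gE {n : ℕ} (E : Finset (Fin n × Fin n)) (π : Equiv.Perm (Fin n)) : ℕ :=
  (univ.filter fun i : Fin n => (i, π i) ∈ E).card

theorem aux_mgf (n : ℕ) (f : Fin (n+1) → ℝ) (a l : ℝ) (hl0 : 0 ≤ l) (hl : l ≤ 1/2)
    (h1 : ∀ p, a ≤ f p) (h2 : ∀ p, f p ≤ a + 2) :
    ∑ p, Real.exp (-(l * f p)) ≤
      ((n : ℝ)+1) * Real.exp (4 * l^2 - l * ((∑ p, f p) / ((n:ℝ)+1))) := by
  have hn : (0:ℝ) < (n:ℝ)+1 := by positivity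
  obtain ⟨m, hm⟩ : ∃ m, m = (∑ p, f p) / ((n:ℝ)+1) := ⟨_, rfl⟩
  have hsum : ∑ p, f p = ((n:ℝ)+1) * m := by rw [hm]; field_simp
  have hma : a ≤ m := by
    have : ∑ p : Fin (n+1), a ≤ ∑ p, f p := Finset.sum_le_sum fun p _ => h1 p
    simp at this
    rw [hsum] at this
    exact le_of_mul_le_mul_left this hn
  have hmb : m ≤ a + 2 := by
    have : ∑ p, f p ≤ ∑ p : Fin (n+1), (a+2) := Finset.sum_le_sum fun p _ => h2 p
    rw [hsum, Finset.sum_const, Finset.card_univ, Fintype.card_fin, nsmul_eq_mul] at this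
    push_cast at this
    exact le_of_mul_le_mul_left this hn
  rw [← hm]
  have key : ∀ p, Real.exp (-(l * f p)) ≤
      Real.exp (-(l*m)) * (1 + l * (m - f p) + 4 * l^2) := by
    intro p
    have e : -(l * f p) = -(l*m) + l * (m - f p) := by ring
    rw [e, Real.exp_add]
    have hd : |m - f p| ≤ 2 := by
      rw [abs_le]; constructor <;> linarith [h1 p, h2 p]
    have hx : |l * (m - f p)| ≤ 1 := by
      rw [abs_mul, abs_of_nonneg hl0]
      nlinarith [abs_nonneg (m - f p)]
    have := (abs_le.1 (Real.abs_exp_sub_one_sub_id_le hx)).2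
    have hsq : (m - f p)^2 ≤ 4 := by
      have := sq_le_sq' (abs_le.1 hd).1 (abs_le.1 hd).2
      linarith
    have hsq2 : (l * (m - f p))^2 ≤ 4 * l^2 := by
      rw [mul_pow]; nlinarith [sq_nonneg l]
    apply mul_le_mul_of_nonneg_left _ (Real.exp_pos _).le
    linarith
  calc ∑ p, Real.exp (-(l * f p))
      ≤ ∑ p, Real.exp (-(l*m)) * (1 + l * (m - f p) + 4 * l^2) :=
        Finset.sum_le_sum fun p _ => key p
    _ = ((n:ℝ)+1) * (Real.exp (-(l*m)) * (1 + 4*l^2)) := by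
        rw [← Finset.mul_sum, Finset.sum_add_distrib, Finset.sum_add_distrib, ← Finset.mul_sum,
          Finset.sum_sub_distrib, hsum]
        simp
        ring
    _ ≤ ((n:ℝ)+1) * Real.exp (4 * l^2 - l * m) := by
        apply mul_le_mul_of_nonneg_left _ hn.le
        rw [sub_eq_add_neg, add_comm (4 * l^2), Real.exp_add]
        apply mul_le_mul_of_nonneg_left _ (Real.exp_pos _).le
        linarith [Real.add_one_le_exp (4*l^2)]

theorem aux_perm (l : ℝ) (hl0 : 0 ≤ l) (hl : l ≤ 1/2) (n : ℕ) :
    ∀ A : Fin n → Fin n → ℝ, (∀ i j, 0 ≤ A i j) → (∀ i j, A i j ≤ 1) →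
    ∑ π : Equiv.Perm (Fin n), Real.exp (-(l * ∑ i, A i (π i))) ≤
      (n.factorial : ℝ) * Real.exp (4 * l^2 * n - l * ((∑ i, ∑ j, A i j) / n)) := by
  induction n with
  | zero => intro A _ _; simp
  | succ n ih =>
    intro A h0 h1
    obtain ⟨T, hT⟩ : ∃ T, T = ∑ x : Fin n, ∑ z, A x.succ z := ⟨_, rfl⟩
    obtain ⟨c, hc⟩ : ∃ c : Fin (n+1) → ℝ, c = fun p => ∑ x : Fin n, A x.succ p := ⟨_, rfl⟩
    have hc0 : ∀ p, 0 ≤ c p := fun p => by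
      rw [hc]; exact Finset.sum_nonneg fun x _ => h0 _ _
    have hc1 : ∀ p, c p ≤ n := fun p => by
      rw [hc]
      have : ∑ x : Fin n, A x.succ p ≤ ∑ x : Fin n, (1:ℝ) :=
        Finset.sum_le_sum fun x _ => h1 _ _
      simpa using this
    have hcT : ∑ p, c p = T := by rw [hc, hT]; exact Finset.sum_comm
    have hB : ∀ p : Fin (n+1),
        ∑ x : Fin n, ∑ y : Fin n, A x.succ (Equiv.swap 0 p y.succ) = T - c p := by
      intro p
      rw [hT, hc, ← Finset.sum_sub_distrib]
      refine Finset.sum_congr rfl fun x _ => ?_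
      have e := Equiv.sum_comp (Equiv.swap 0 p) (fun w => A x.succ w)
      rw [Fin.sum_univ_succ] at e
      simp only [Equiv.swap_apply_left] at e
      linarith
    have hdiv : ∀ p, 0 ≤ c p / n ∧ c p / n ≤ 1 := fun p =>
      ⟨div_nonneg (hc0 p) (Nat.cast_nonneg n), div_le_one_of_le₀ (hc1 p) (Nat.cast_nonneg n)⟩
    have hmgf := aux_mgf n (fun p => A 0 p + (T - c p) / n) (T / n - 1) l hl0 hl
      (fun p => by
        have := hdiv p; have := h0 0 p
        simp only [sub_div]; linarith)
      (fun p => by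
        have := hdiv p; have := h1 0 p
        simp only [sub_div]; linarith)
    have hmean : ∑ p, (A 0 p + (T - c p) / n) = ∑ i, ∑ j, A i j := by
      rw [Fin.sum_univ_succ (fun i => ∑ j, A i j), ← hT, Finset.sum_add_distrib,
        ← Finset.sum_div, Finset.sum_sub_distrib, hcT]
      congr 1
      rcases Nat.eq_zero_or_pos n with h | h
      · subst h; simp [hT]
      · have : (0:ℝ) < n := by exact_mod_cast h
        simp
        field_simp
        ring
    rw [hmean] at hmgf
    rw [← Equiv.sum_comp (Equiv.Perm.decomposeFin (n := n)).symm, Fintype.sum_prod_type]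
    calc _ = ∑ p : Fin (n+1), Real.exp (-(l * A 0 p)) * ∑ e : Equiv.Perm (Fin n),
            Real.exp (-(l * ∑ x : Fin n, A x.succ (Equiv.swap 0 p (e x).succ))) := by
          refine Finset.sum_congr rfl fun p _ => ?_
          rw [Finset.mul_sum]
          refine Finset.sum_congr rfl fun e _ => ?_
          rw [Fin.sum_univ_succ, ← Real.exp_add]
          simp only [Equiv.Perm.decomposeFin_symm_apply_zero,
            Equiv.Perm.decomposeFin_symm_apply_succ]
          congr 1
          ring
      _ ≤ ∑ p : Fin (n+1), Real.exp (-(l * A 0 p)) * ((n.factorial : ℝ) *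
            Real.exp (4 * l^2 * n - l * ((T - c p) / n))) := by
          refine Finset.sum_le_sum fun p _ => mul_le_mul_of_nonneg_left ?_ (Real.exp_pos _).le
          have := ih (fun x y => A x.succ (Equiv.swap 0 p y.succ))
            (fun _ _ => h0 _ _) (fun _ _ => h1 _ _)
          rw [hB p] at this
          exact this
      _ = (n.factorial : ℝ) * Real.exp (4 * l^2 * n) *
            ∑ p : Fin (n+1), Real.exp (-(l * (A 0 p + (T - c p) / n))) := by
          rw [Finset.mul_sum]
          refine Finset.sum_congr rfl fun p _ => ?_
          have e1 : -(l * (A 0 p + (T - c p) / n)) = -(l * A 0 p) + -(l * ((T - c p) / n)) := by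
            ring
          rw [e1, Real.exp_add, sub_eq_add_neg, Real.exp_add]
          ring
      _ ≤ (n.factorial : ℝ) * Real.exp (4 * l^2 * n) * (((n : ℝ)+1) *
            Real.exp (4 * l^2 - l * ((∑ i, ∑ j, A i j) / ((n:ℝ)+1)))) :=
          mul_le_mul_of_nonneg_left hmgf (by positivity)
      _ = _ := by
          have e2 : 4 * l^2 * ((n+1 : ℕ) : ℝ) - l * ((∑ i, ∑ j, A i j) / ((n+1 : ℕ):ℝ)) =
            4 * l^2 * n + (4 * l^2 - l * ((∑ i, ∑ j, A i j) / ((n:ℝ)+1))) := by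
            push_cast; ring
          rw [e2, Real.exp_add, Nat.factorial_succ]
          push_cast
          ring

theorem aux_count (n : ℕ) (γ : ℝ) (hγ0 : 0 < γ) (hγ1 : γ ≤ 1)
    (E : Finset (Fin n × Fin n)) (hE : γ * (n : ℝ) ^ 2 ≤ (E.card : ℝ)) :
    (((univ : Finset (Equiv.Perm (Fin n))).filter fun π =>
          (gE E π : ℝ) ≤ γ * (n : ℝ) / 10).card : ℝ) ≤
        (n.factorial : ℝ) * Real.exp (-(γ ^ 2 * (n : ℝ) / 20)) := by
  have h := aux_perm (γ/10) (by positivity) (by linarith) n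
    (fun i j => if (i, j) ∈ E then 1 else 0)
    (fun i j => by split_ifs <;> norm_num)
    (fun i j => by split_ifs <;> norm_num)
  have hS : ∑ i : Fin n, ∑ j : Fin n, (if (i, j) ∈ E then (1:ℝ) else 0) = E.card := by
    rw [← Fintype.sum_prod_type (f := fun q : Fin n × Fin n => if q ∈ E then (1:ℝ) else 0)]
    simp
  have hg : ∀ π : Equiv.Perm (Fin n),
      ∑ i : Fin n, (if (i, π i) ∈ E then (1:ℝ) else 0) = gE E π := by
    intro π
    simp [gE]
  simp only [hS, hg] at h
  have hmean : γ * n ≤ (E.card : ℝ) / n := by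
    rcases Nat.eq_zero_or_pos n with h | h
    · subst h; simp
    · have : (0:ℝ) < n := by exact_mod_cast h
      rw [le_div_iff₀ this]; linarith
  have h2 : (((univ : Finset (Equiv.Perm (Fin n))).filter fun π =>
          (gE E π : ℝ) ≤ γ * (n : ℝ) / 10).card : ℝ) * Real.exp (-(γ/10 * (γ * n / 10))) ≤
      ∑ π : Equiv.Perm (Fin n), Real.exp (-(γ/10 * (gE E π : ℝ))) := by
    rw [← nsmul_eq_mul, ← Finset.sum_const]
    refine le_trans (Finset.sum_le_sum fun π hπ => ?_)
      (Finset.sum_le_sum_of_subset_of_nonneg (Finset.filter_subset _ _)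
        fun _ _ _ => (Real.exp_pos _).le)
    rw [Finset.mem_filter] at hπ
    apply Real.exp_le_exp.2
    apply neg_le_neg
    exact mul_le_mul_of_nonneg_left hπ.2 (by positivity)
  have h3 := h2.trans h
  have h4 : Real.exp (4 * (γ/10)^2 * n - γ/10 * ((E.card : ℝ) / n)) ≤
      Real.exp (-(γ ^ 2 * (n : ℝ) / 20)) * Real.exp (-(γ/10 * (γ * n / 10))) := by
    rw [← Real.exp_add]
    apply Real.exp_le_exp.2
    have := mul_le_mul_of_nonneg_left hmean (show 0 ≤ γ/10 by positivity)
    nlinarith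
  have h5 := h3.trans (mul_le_mul_of_nonneg_left h4 (Nat.cast_nonneg n.factorial))
  rw [← mul_assoc] at h5
  exact le_of_mul_le_mul_right h5 (Real.exp_pos _)

/-- **Maurey-type bound (the `k = 0` case).** Let `0 < γ ≤ 1` and `E ⊆ [n]²` with
`|E| ≥ γ·n²`.  Then a uniformly random permutation `π` of `[n]` satisfies
`P[g_E(π) ≤ γn/10] < 2·e^{−γ²n/20}`; equivalently, the number of permutations with
`g_E(π) ≤ γn/10` is less than `2·n!·e^{−γ²n/20}`. -/
theorem few_permutations_with_small_gE (n : ℕ) (γ : ℝ) (hγ0 : 0 < γ) (hγ1 : γ ≤ 1)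
    (E : Finset (Fin n × Fin n)) (hE : γ * (n : ℝ) ^ 2 ≤ (E.card : ℝ)) :
    (((univ : Finset (Equiv.Perm (Fin n))).filter fun π =>
          (gE E π : ℝ) ≤ γ * (n : ℝ) / 10).card : ℝ) /
        ((univ : Finset (Equiv.Perm (Fin n))).card : ℝ) <
        2 * Real.exp (-(γ ^ 2 * (n : ℝ) / 20)) ∧
      (((univ : Finset (Equiv.Perm (Fin n))).filter fun π =>
          (gE E π : ℝ) ≤ γ * (n : ℝ) / 10).card : ℝ) <
        2 * (n.factorial : ℝ) * Real.exp (-(γ ^ 2 * (n : ℝ) / 20)) := by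
  have h := aux_count n γ hγ0 hγ1 E hE
  have hf : (0:ℝ) < n.factorial := by exact_mod_cast n.factorial_pos
  have hp : 0 < (n.factorial : ℝ) * Real.exp (-(γ ^ 2 * (n : ℝ) / 20)) :=
    mul_pos hf (Real.exp_pos _)
  refine ⟨?_, by linarith⟩
  rw [Finset.card_univ (α := Equiv.Perm (Fin n)), Fintype.card_perm, Fintype.card_fin,
    div_lt_iff₀ hf]
  linarith
end
end

section
/- Let n ≥ 1, let k ≤ n/4, let A_1,…,A_n ⊆ [n] with |A_i| ≤ n/2 for all i, and let B_1,…,B_n ⊆ [n] with |B_i| = k for all i. Set R_i = A_i∖B_i, r_i = |R_i|, p_i = r_i/(n−k), and let Y = Y_1 + ⋯ + Y_n where Y_1,…,Y_n are independent random variables with P[Y_i = 1] = p_i = 1 − P[Y_i = 0]. Then for every 0 ≤ m ≤ n, the number of permutations π of [n] satisfying π(i) ∉ B_i for all i and |{i : π(i) ∈ A_i}| = m is at most 4n² · e^m · ((n−k)/e)^n · P[Y = m], where e is Euler's number. -/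
open Finset
open scoped Classical

noncomputable section


/-- Permutations compatible with a family of sets. -/
def bregP {n : ℕ} (A : Fin n → Finset (Fin n)) : Finset (Equiv.Perm (Fin n)) :=
  univ.filter fun σ => ∀ i, σ i ∈ A i

lemma mem_bregP {n : ℕ} (A : Fin n → Finset (Fin n)) (σ : Equiv.Perm (Fin n)) :
    σ ∈ bregP A ↔ ∀ i, σ i ∈ A i := by
  unfold bregP
  exact ⟨fun h => (mem_filter.mp h).2, fun h => mem_filter.mpr ⟨mem_univ _, h⟩⟩

/-- The function log(r!)/r. -/
def bregF (r : ℕ) : ℝ := Real.log (r.factorial : ℝ) / r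

lemma bregF_nonneg (r : ℕ) : 0 ≤ bregF r := by
  unfold bregF
  apply div_nonneg _ (Nat.cast_nonneg _)
  apply Real.log_nonneg
  exact_mod_cast Nat.one_le_iff_ne_zero.mpr (Nat.factorial_ne_zero r)

lemma bregF_mul (r : ℕ) : (r : ℝ) * bregF r = Real.log (r.factorial : ℝ) := by
  unfold bregF
  rcases Nat.eq_zero_or_pos r with h | h
  · subst h; simp
  · field_simp

lemma bregF_rec (r : ℕ) (hr : 1 ≤ r) :
    Real.log r + ((r : ℝ) - 1) * bregF (r - 1) = r * bregF r := by
  obtain ⟨t, rfl⟩ : ∃ t, r = t + 1 := ⟨r - 1, by omega⟩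
  rw [bregF_mul]
  have h : (((t + 1 : ℕ) : ℝ) - 1) = (t : ℝ) := by push_cast; ring
  rw [h, Nat.add_sub_cancel, bregF_mul, Nat.factorial_succ, Nat.cast_mul, Real.log_mul]
  · positivity
  · exact_mod_cast Nat.factorial_ne_zero t

lemma gibbs {ι : Type*} (s : Finset ι) (N : ℝ) (x : ι → ℝ) (hx : ∀ i ∈ s, 0 ≤ x i)
    (hN : 0 < N) (hs : ∑ i ∈ s, x i = N) :
    N * Real.log N ≤ N * Real.log s.card + ∑ i ∈ s, x i * Real.log (x i) := by
  have hne : s.Nonempty := by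
    rw [nonempty_iff_ne_empty]; rintro rfl; simp at hs; linarith
  have hr : (0 : ℝ) < s.card := by exact_mod_cast hne.card_pos
  have key : ∀ i ∈ s, x i * (Real.log N - Real.log s.card) + x i - N / s.card
      ≤ x i * Real.log (x i) := by
    intro i hi
    rcases (hx i hi).eq_or_lt with h | h
    · rw [← h]; have : 0 ≤ N / s.card := by positivity
      linarith
    · have h1 := Real.log_le_sub_one_of_pos (show 0 < N / s.card / x i by positivity)
      rw [Real.log_div (by positivity) h.ne', Real.log_div hN.ne' hr.ne'] at h1
      have h2 := mul_le_mul_of_nonneg_left h1 h.le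
      have h3 : x i * (N / s.card / x i - 1) = N / s.card - x i := by field_simp
      rw [h3] at h2
      linarith
  have h := sum_le_sum key
  rw [sum_sub_distrib, sum_add_distrib, ← sum_mul, hs, sum_const, nsmul_eq_mul,
    mul_div_cancel₀ _ hr.ne'] at h
  linarith

/-- The minor obtained by forcing i to k. -/
def bregM {n : ℕ} (A : Fin n → Finset (Fin n)) (i k : Fin n) : Fin n → Finset (Fin n) :=
  fun j => if j = i then {k} else (A j).erase k

lemma mem_bregM {n : ℕ} (A : Fin n → Finset (Fin n)) (i k : Fin n) (hk : k ∈ A i) :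
    bregP (bregM A i k) = (bregP A).filter fun σ => σ i = k := by
  ext σ
  rw [mem_filter, mem_bregP, mem_bregP]
  simp only [bregM]
  constructor
  · intro h
    have hi : σ i = k := by simpa using h i
    refine ⟨fun j => ?_, hi⟩
    by_cases hj : j = i
    · subst hj; rw [hi]; exact hk
    · have := h j
      rw [if_neg hj] at this
      exact mem_of_mem_erase this
  · rintro ⟨h, hi⟩ j
    by_cases hj : j = i
    · subst hj; simp [hi]
    · rw [if_neg hj, mem_erase]
      refine ⟨fun e => hj (σ.injective (e.trans hi.symm)), h j⟩

lemma breg_inner {n : ℕ} (S : Finset (Fin n)) (A : Fin n → Finset (Fin n))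
    (hd : ∀ i, i ∉ S → ∀ j, j ≠ i → Disjoint (A i) (A j))
    (σ : Equiv.Perm (Fin n)) (hσ : σ ∈ bregP A) (j : Fin n) (hj : j ∈ S) :
    Real.log (A j).card + ∑ i ∈ S.erase j, bregF ((A j).erase (σ i)).card
      = S.card * bregF (A j).card := by
  have hσ' : ∀ i, σ i ∈ A i := by simpa [bregP] using hσ
  have hr : 1 ≤ (A j).card := card_pos.mpr ⟨_, hσ' j⟩
  have hsub : ∀ i, σ i ∈ A j → i ∈ S := by
    intro i hi
    by_contra hiS
    have hne : j ≠ i := by rintro rfl; exact hiS hj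
    exact disjoint_left.mp (hd i hiS j hne) (hσ' i) hi
  have hc : (S.filter fun i => σ i ∈ A j).card = (A j).card := by
    apply card_bij (fun i _ => σ i)
    · intro i hi; exact (mem_filter.mp hi).2
    · intro a _ b _ h; exact σ.injective h
    · intro b hb
      refine ⟨σ.symm b, ?_, by simp⟩
      have : σ (σ.symm b) ∈ A j := by simpa using hb
      exact mem_filter.mpr ⟨hsub _ this, this⟩
  have h1 : ∀ i, bregF ((A j).erase (σ i)).card
      = if σ i ∈ A j then bregF ((A j).card - 1) else bregF (A j).card := by
    intro i
    split_ifs with h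
    · rw [card_erase_of_mem h]
    · rw [erase_eq_of_notMem h]
  have h2 : ∑ i ∈ S, bregF ((A j).erase (σ i)).card
      = (A j).card * bregF ((A j).card - 1) + ((S.card : ℝ) - (A j).card) * bregF (A j).card := by
    simp_rw [h1]
    rw [sum_ite, sum_const, sum_const, nsmul_eq_mul, nsmul_eq_mul, hc]
    have h3 := card_filter_add_card_filter_not (s := S) (fun i => σ i ∈ A j)
    rw [hc] at h3
    have h4 : ((A j).card : ℝ) + ((S.filter fun i => ¬ σ i ∈ A j).card : ℝ) = S.card := by
      exact_mod_cast h3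
    rw [← h4]; ring
  have h5 := add_sum_erase S (fun i => bregF ((A j).erase (σ i)).card) hj
  rw [h2, card_erase_of_mem (hσ' j)] at h5
  have h6 := bregF_rec _ hr
  linarith

lemma bregman_aux {n : ℕ} (N : ℕ) : ∀ (S : Finset (Fin n)) (A : Fin n → Finset (Fin n)),
    S.card = N → (∀ i, i ∉ S → (A i).card = 1) →
    (∀ i, i ∉ S → ∀ j, j ≠ i → Disjoint (A i) (A j)) →
    Real.log (bregP A).card ≤ ∑ i ∈ S, bregF (A i).card := by
  induction N with
  | zero =>
    intro S A hS h1 _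
    rw [card_eq_zero] at hS
    subst hS
    have : (bregP A).card ≤ 1 := by
      rw [card_le_one]
      intro a ha b hb
      ext i
      have ha' : ∀ i, a i ∈ A i := by simpa [bregP] using ha
      have hb' : ∀ i, b i ∈ A i := by simpa [bregP] using hb
      have := card_le_one.mp (h1 i (by simp)).le _ (ha' i) _ (hb' i)
      rw [this]
    rw [sum_empty]
    apply Real.log_nonpos (by positivity)
    exact_mod_cast this
  | succ N ih =>
    intro S A hS h1 hd
    rcases Nat.eq_zero_or_pos (bregP A).card with h0 | hpos
    · rw [h0]; simp only [Nat.cast_zero, Real.log_zero]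
      exact sum_nonneg fun i _ => bregF_nonneg _
    have hpos' : (0 : ℝ) < (bregP A).card := by exact_mod_cast hpos
    have hmem : ∀ σ ∈ bregP A, ∀ i, σ i ∈ A i := by
      intro σ hσ; simpa [bregP] using hσ
    have hIH : ∀ i ∈ S, ∀ k ∈ A i, Real.log (bregP (bregM A i k)).card
        ≤ ∑ j ∈ S.erase i, bregF ((A j).erase k).card := by
      intro i hi k hk
      have := ih (S.erase i) (bregM A i k) (by rw [card_erase_of_mem hi, hS]; rfl) ?_ ?_
      · refine this.trans (le_of_eq (sum_congr rfl fun j hj => ?_))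
        rw [bregM, if_neg (mem_erase.mp hj).1]
      · intro l hl
        by_cases hli : l = i
        · subst hli; simp [bregM]
        · have hlS : l ∉ S := fun h => hl (mem_erase.mpr ⟨hli, h⟩)
          have hkl : k ∉ A l := fun h =>
            disjoint_left.mp (hd l hlS i (Ne.symm hli)) h hk
          rw [bregM, if_neg hli, erase_eq_of_notMem hkl]
          exact h1 l hlS
      · intro l hl j hjl
        by_cases hli : l = i
        · subst hli; simp [bregM, hjl]
        · have hlS : l ∉ S := fun h => hl (mem_erase.mpr ⟨hli, h⟩)
          by_cases hji : j = i
          · subst hji; simp [bregM, hli]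
          · simp only [bregM, if_neg hli, if_neg hji]
            exact (hd l hlS j hjl).mono (erase_subset _ _) (erase_subset _ _)
    have hrow : ∀ i ∈ S, (bregP A).card * Real.log (bregP A).card ≤
        ∑ σ ∈ bregP A, (Real.log (A i).card
          + ∑ j ∈ S.erase i, bregF ((A j).erase (σ i)).card) := by
      intro i hi
      have hfib : ∑ k ∈ A i, ((bregP (bregM A i k)).card : ℝ) = (bregP A).card := by
        rw [card_eq_sum_card_fiberwise (f := fun σ => σ i) (t := A i)
          (fun σ hσ => hmem σ hσ i), Nat.cast_sum]
        refine sum_congr rfl fun k hk => ?_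
        rw [mem_bregM A i k hk]
      have hg := gibbs (A i) (bregP A).card (fun k => ((bregP (bregM A i k)).card : ℝ))
        (fun _ _ => Nat.cast_nonneg _) hpos' hfib
      refine hg.trans ?_
      rw [sum_add_distrib, sum_const, nsmul_eq_mul]
      refine add_le_add le_rfl ?_
      rw [← sum_fiberwise_of_maps_to (s := bregP A) (t := A i) (g := fun σ => σ i)
        (fun σ hσ => hmem σ hσ i)]
      refine sum_le_sum fun k hk => ?_
      have : ∑ σ ∈ (bregP A).filter (fun σ => σ i = k),
          ∑ j ∈ S.erase i, bregF ((A j).erase (σ i)).card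
          = ∑ σ ∈ (bregP A).filter (fun σ => σ i = k),
          ∑ j ∈ S.erase i, bregF ((A j).erase k).card := by
        refine sum_congr rfl fun σ hσ => ?_
        rw [(mem_filter.mp hσ).2]
      rw [this, sum_const, nsmul_eq_mul, ← mem_bregM A i k hk]
      exact mul_le_mul_of_nonneg_left (hIH i hi k hk) (Nat.cast_nonneg _)
    have hsum := sum_le_sum hrow
    rw [sum_const, nsmul_eq_mul, sum_comm] at hsum
    have hin : ∀ σ ∈ bregP A, ∑ i ∈ S, (Real.log (A i).card
          + ∑ j ∈ S.erase i, bregF ((A j).erase (σ i)).card)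
        = S.card * ∑ j ∈ S, bregF (A j).card := by
      intro σ hσ
      rw [mul_sum, ← sum_congr rfl (fun j hj => breg_inner S A hd σ hσ j hj),
        sum_add_distrib, sum_add_distrib]
      congr 1
      apply sum_comm'
      intro a b
      simp only [mem_erase]
      tauto
    rw [sum_congr rfl hin, sum_const, nsmul_eq_mul] at hsum
    have hSpos : (0 : ℝ) < S.card := by rw [hS]; positivity
    have : ((S.card : ℝ) * (bregP A).card) * Real.log (bregP A).card ≤
        ((S.card : ℝ) * (bregP A).card) * ∑ j ∈ S, bregF (A j).card := by
      linarith
    exact le_of_mul_le_mul_left this (by positivity)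

lemma bregman {n : ℕ} (A : Fin n → Finset (Fin n)) :
    Real.log (bregP A).card ≤ ∑ i, bregF (A i).card :=
  bregman_aux _ univ A rfl (by simp) (by simp)

lemma bregF_le_log (r : ℕ) (hr : 1 ≤ r) : bregF r ≤ Real.log r := by
  have hr' : (0 : ℝ) < r := by exact_mod_cast hr
  rw [bregF, div_le_iff₀ hr', mul_comm, ← Real.log_pow]
  apply Real.log_le_log
  · exact_mod_cast Nat.factorial_pos r
  · exact_mod_cast Nat.factorial_le_pow r

lemma log_fact_le (s : ℕ) (hs : 1 ≤ s) :
    Real.log (s.factorial : ℝ) ≤ s * (Real.log s - 1) + 1 + Real.log s / 2 := by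
  have hs' : (0 : ℝ) < s := by exact_mod_cast hs
  have h := Stirling.log_stirlingSeq'_antitone (Nat.zero_le (s - 1))
  simp only [Function.comp, Nat.succ_eq_add_one, Nat.sub_add_cancel hs] at h
  rw [Stirling.log_stirlingSeq_formula, Stirling.log_stirlingSeq_formula] at h
  rw [Real.log_mul (by norm_num) hs'.ne', Real.log_div hs'.ne' (Real.exp_pos _).ne',
    Real.log_exp] at h
  simp at h
  linarith

lemma bregF_le (n s : ℕ) (hn : 1 ≤ n) (hs : 1 ≤ s) (h4 : (n : ℝ) / 4 ≤ s) (hsn : s ≤ n) :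
    bregF s ≤ Real.log s - 1 + Real.log (4 * (n : ℝ) ^ 2) / n := by
  have hs' : (0 : ℝ) < s := by exact_mod_cast hs
  have hn' : (0 : ℝ) < n := by exact_mod_cast hn
  have hl := log_fact_le s hs
  have l2 : (0.6931471803 : ℝ) < Real.log 2 := Real.log_two_gt_d9
  have e1 : Real.log (4 * (n : ℝ) ^ 2) = 2 * Real.log 2 + 2 * Real.log n := by
    rw [Real.log_mul (by norm_num) (by positivity), Real.log_pow,
      show (4 : ℝ) = 2 ^ 2 by norm_num, Real.log_pow]
    push_cast; ring
  have main : (n : ℝ) * (1 + Real.log s / 2) ≤ s * (2 * Real.log 2 + 2 * Real.log n) := by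
    rcases Nat.lt_or_ge n 2 with h | h
    · have : n = 1 := by omega
      subst this
      have : s = 1 := by omega
      subst this
      simp; linarith
    · have hln : Real.log 2 ≤ Real.log n :=
        Real.log_le_log (by norm_num) (by exact_mod_cast h)
      have h1 := Real.log_le_sub_one_of_pos (show 0 < (s : ℝ) / (n / 4) by positivity)
      rw [Real.log_div hs'.ne' (by positivity), Real.log_div hn'.ne' (by norm_num),
        show (4 : ℝ) = 2 ^ 2 by norm_num, Real.log_pow] at h1
      push_cast at h1
      have h2 := mul_le_mul_of_nonneg_left h1 hn'.le
      have h3 : (n : ℝ) * (s / (n / 2 ^ 2) - 1) = 4 * s - n := by field_simp; ring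
      rw [h3] at h2
      have h5 : (0 : ℝ) ≤ (s - n / 4) * (Real.log 2 + Real.log n - 1) :=
        mul_nonneg (by linarith) (by linarith)
      nlinarith
  rw [bregF, div_le_iff₀ hs', e1]
  have h6 : (Real.log s - 1 + (2 * Real.log 2 + 2 * Real.log n) / n) * s
      = s * (Real.log s - 1) + s * (2 * Real.log 2 + 2 * Real.log n) / n := by ring
  have h7 : 1 + Real.log s / 2 ≤ s * (2 * Real.log 2 + 2 * Real.log n) / n := by
    rw [le_div_iff₀ hn']; linarith
  rw [h6]; linarith

lemma breg_term (n : ℕ) (hn : 1 ≤ n) (r s : Fin n → ℕ) (I : Finset (Fin n))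
    (T : Fin n → Finset (Fin n)) (hTr : ∀ i ∈ I, (T i).card = r i)
    (hTs : ∀ i ∈ Iᶜ, (T i).card = s i)
    (hs1 : ∀ i, 1 ≤ s i) (hs4 : ∀ i, (n : ℝ) / 4 ≤ s i) (hsn : ∀ i, s i ≤ n) :
    ((bregP T).card : ℝ) ≤ 4 * (n : ℝ) ^ 2 * ((∏ i ∈ I, (r i : ℝ)) *
      ∏ i ∈ Iᶜ, ((s i : ℝ) / Real.exp 1)) := by
  have hn' : (0 : ℝ) < n := by exact_mod_cast hn
  have hnn : (0 : ℝ) ≤ 4 * (n : ℝ) ^ 2 * ((∏ i ∈ I, (r i : ℝ)) *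
      ∏ i ∈ Iᶜ, ((s i : ℝ) / Real.exp 1)) := by positivity
  rcases (bregP T).eq_empty_or_nonempty with h0 | ⟨σ, hσ⟩
  · rw [h0]; simpa using hnn
  have hpos : (0 : ℝ) < (bregP T).card := by exact_mod_cast card_pos.mpr ⟨σ, hσ⟩
  have hσ' : ∀ i, σ i ∈ T i := by simpa [bregP] using hσ
  have hr1 : ∀ i ∈ I, 1 ≤ r i := by
    intro i hi; rw [← hTr i hi]; exact card_pos.mpr ⟨_, hσ' i⟩
  have hr0 : ∀ i ∈ I, (r i : ℝ) ≠ 0 := fun i hi => by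
    have := hr1 i hi; positivity
  have hs0 : ∀ i ∈ Iᶜ, (s i : ℝ) / Real.exp 1 ≠ 0 := fun i hi => by
    have := hs1 i; positivity
  have hL : (0 : ℝ) ≤ Real.log (4 * (n : ℝ) ^ 2) := by
    apply Real.log_nonneg
    have : (1 : ℝ) ≤ n := by exact_mod_cast hn
    nlinarith
  have hp1 : ∏ i ∈ I, (r i : ℝ) ≠ 0 := prod_ne_zero_iff.mpr hr0
  have hp2 : ∏ i ∈ Iᶜ, ((s i : ℝ) / Real.exp 1) ≠ 0 := prod_ne_zero_iff.mpr hs0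
  rw [← Real.log_le_log_iff hpos (lt_of_le_of_ne hnn (Ne.symm (by positivity))),
    Real.log_mul (by positivity) (mul_ne_zero hp1 hp2), Real.log_mul hp1 hp2,
    Real.log_prod hr0, Real.log_prod hs0]
  refine (bregman T).trans ?_
  rw [← sum_add_sum_compl I]
  have b1 : ∑ i ∈ I, bregF (T i).card ≤ ∑ i ∈ I, Real.log (r i) :=
    sum_le_sum fun i hi => by rw [hTr i hi]; exact bregF_le_log _ (hr1 i hi)
  have b2 : ∑ i ∈ Iᶜ, bregF (T i).card ≤ ∑ i ∈ Iᶜ, (Real.log ((s i : ℝ) / Real.exp 1)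
      + Real.log (4 * (n : ℝ) ^ 2) / n) :=
    sum_le_sum fun i hi => by
      rw [hTs i hi, Real.log_div (by have := hs1 i; positivity) (Real.exp_pos _).ne', Real.log_exp]
      exact bregF_le n _ hn (hs1 i) (hs4 i) (hsn i)
  rw [sum_add_distrib, sum_const, nsmul_eq_mul] at b2
  have b3 : ((Iᶜ).card : ℝ) * (Real.log (4 * (n : ℝ) ^ 2) / n) ≤ Real.log (4 * (n : ℝ) ^ 2) := by
    have : ((Iᶜ).card : ℝ) ≤ n := by
      exact_mod_cast (card_le_univ (Iᶜ)).trans (by simp)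
    calc _ ≤ (n : ℝ) * (Real.log (4 * (n : ℝ) ^ 2) / n) :=
          mul_le_mul_of_nonneg_right this (by positivity)
      _ = _ := by field_simp
  linarith

lemma breg_final (c a b q e : ℝ) (n m : ℕ) (hm : m ≤ n) (hq : q ≠ 0) (he : e ≠ 0) :
    c * (a * (b / e ^ (n - m))) =
      c * e ^ m * (q ^ n / e ^ n) * (a / q ^ m * (b / q ^ (n - m))) := by
  have hE : e ^ n = e ^ m * e ^ (n - m) := by
    rw [← pow_add, Nat.add_sub_cancel' hm]
  have hQ : q ^ n = q ^ m * q ^ (n - m) := by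
    rw [← pow_add, Nat.add_sub_cancel' hm]
  rw [hE, hQ]
  have h1 : e ^ m ≠ 0 := pow_ne_zero _ he
  have h2 : e ^ (n - m) ≠ 0 := pow_ne_zero _ he
  have h3 : q ^ m ≠ 0 := pow_ne_zero _ hq
  have h4 : q ^ (n - m) ≠ 0 := pow_ne_zero _ hq
  generalize e ^ m = x at *
  generalize e ^ (n - m) = y at *
  generalize q ^ m = z at *
  generalize q ^ (n - m) = w at *
  field_simp

/-- **Claim (Brégman-type bound via Bernoulli variables).** Let `n ≥ 1`, `k ≤ n/4`,
`A_1,…,A_n ⊆ [n]` with `|A_i| ≤ n/2`, and `B_1,…,B_n ⊆ [n]` with `|B_i| = k`.  Set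
`R_i = A_i ∖ B_i`, `r_i = |R_i|` and `p_i = r_i/(n−k)`, and let `Y = Y_1 + ⋯ + Y_n`
with `Y_i` independent Bernoulli variables, `P[Y_i = 1] = p_i`; thus
`P[Y = m] = Σ_{|I|=m} ∏_{i∈I} p_i ∏_{i∉I} (1 − p_i)`.  Then for every `0 ≤ m ≤ n`,
the number of permutations `π` of `[n]` with `π(i) ∉ B_i` for all `i` and
`|{i : π(i) ∈ A_i}| = m` is at most `4n² · eᵐ · ((n−k)/e)ⁿ · P[Y = m]`. -/
theorem count_restricted_permutations_binomial (n k m : ℕ) (hn : 1 ≤ n)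
    (hk : (k : ℝ) ≤ (n : ℝ) / 4) (hm : m ≤ n)
    (A : Fin n → Finset (Fin n)) (hA : ∀ i, ((A i).card : ℝ) ≤ (n : ℝ) / 2)
    (B : Fin n → Finset (Fin n)) (hB : ∀ i, (B i).card = k) :
    (((univ : Finset (Equiv.Perm (Fin n))).filter fun π =>
        (∀ i, π i ∉ B i) ∧ (univ.filter fun i => π i ∈ A i).card = m).card : ℝ) ≤
      4 * (n : ℝ) ^ 2 * Real.exp m * (((n : ℝ) - (k : ℝ)) / Real.exp 1) ^ n *
        ∑ I ∈ Finset.powersetCard m (univ : Finset (Fin n)),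
          (∏ i ∈ I, (((A i \ B i).card : ℝ) / ((n : ℝ) - (k : ℝ)))) *
            ∏ i ∈ Iᶜ, (1 - ((A i \ B i).card : ℝ) / ((n : ℝ) - (k : ℝ))) := by
  have hn' : (0 : ℝ) < n := by exact_mod_cast hn
  have hq : (0 : ℝ) < (n : ℝ) - k := by linarith
  obtain ⟨T, hT⟩ : ∃ T : Finset (Fin n) → Fin n → Finset (Fin n), ∀ I i, T I i =
    if i ∈ I then A i \ B i else (A i ∪ B i)ᶜ := ⟨_, fun _ _ => rfl⟩
  have hcard : ∀ i, (A i \ B i).card + k + ((A i ∪ B i)ᶜ).card = n := by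
    intro i
    have h1 := card_sdiff_add_card (A i) (B i)
    have h2 := card_add_card_compl (A i ∪ B i)
    rw [Fintype.card_fin] at h2
    rw [hB i] at h1
    omega
  have hcard' : ∀ i, ((A i \ B i).card : ℝ) + k + ((A i ∪ B i)ᶜ).card = n := by
    intro i; exact_mod_cast hcard i
  have hs4 : ∀ i, (n : ℝ) / 4 ≤ (((A i ∪ B i)ᶜ).card : ℝ) := by
    intro i
    have h1 : ((A i \ B i).card : ℝ) ≤ (A i).card := by
      exact_mod_cast card_le_card sdiff_subset
    linarith [hcard' i, hA i]
  have hs1 : ∀ i, 1 ≤ ((A i ∪ B i)ᶜ).card := by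
    intro i
    have : (0 : ℝ) < (((A i ∪ B i)ᶜ).card : ℝ) := lt_of_lt_of_le (by positivity) (hs4 i)
    exact_mod_cast this
  have hcover : ((univ : Finset (Equiv.Perm (Fin n))).filter fun π =>
        (∀ i, π i ∉ B i) ∧ (univ.filter fun i => π i ∈ A i).card = m) ⊆
      (powersetCard m (univ : Finset (Fin n))).biUnion fun I => bregP (T I) := by
    intro π hπ
    obtain ⟨hb, hc⟩ := (mem_filter.mp hπ).2
    rw [mem_biUnion]
    refine ⟨univ.filter fun i => π i ∈ A i, mem_powersetCard.mpr ⟨subset_univ _, hc⟩, ?_⟩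
    rw [mem_bregP]
    intro i
    rw [hT]
    by_cases h : π i ∈ A i
    · simp [h, hb i]
    · simp [h, hb i]
  have hle := (card_le_card hcover).trans card_biUnion_le
  refine le_trans (Nat.cast_le.mpr hle) ?_
  rw [Nat.cast_sum, mul_sum]
  refine sum_le_sum fun I hI => ?_
  have hIc : I.card = m := (mem_powersetCard.mp hI).2
  refine (breg_term n hn (fun i => (A i \ B i).card) (fun i => ((A i ∪ B i)ᶜ).card) I (T I)
    (fun i hi => by simp only [hT, if_pos hi])
    (fun i hi => by simp only [hT, if_neg (mem_compl.mp hi)]) hs1 hs4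
    (fun i => by have := hcard i; omega)).trans (le_of_eq ?_)
  have e1 : ∏ i ∈ I, (((A i \ B i).card : ℝ) / ((n : ℝ) - (k : ℝ)))
      = (∏ i ∈ I, ((A i \ B i).card : ℝ)) / ((n : ℝ) - k) ^ m := by
    rw [prod_div_distrib, prod_const, hIc]
  have hcc : (Iᶜ).card = n - m := by rw [card_compl, Fintype.card_fin, hIc]
  have e2 : ∏ i ∈ Iᶜ, (1 - ((A i \ B i).card : ℝ) / ((n : ℝ) - (k : ℝ)))
      = (∏ i ∈ Iᶜ, (((A i ∪ B i)ᶜ).card : ℝ)) / ((n : ℝ) - k) ^ (n - m) := by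
    rw [← hcc, ← prod_const, ← prod_div_distrib]
    refine prod_congr rfl fun i _ => ?_
    have := hcard' i
    field_simp
    linarith
  have e3 : ∏ i ∈ Iᶜ, ((((A i ∪ B i)ᶜ).card : ℝ) / Real.exp 1)
      = (∏ i ∈ Iᶜ, (((A i ∪ B i)ᶜ).card : ℝ)) / Real.exp 1 ^ (n - m) := by
    rw [prod_div_distrib, prod_const, hcc]
  rw [e1, e2, e3, ← Real.exp_one_pow m, div_pow]
  exact breg_final _ _ _ _ _ n m hm hq.ne' (Real.exp_pos 1).ne'
end
end

section
/- Let 0 ≤ k < n and let B_1,…,B_n ⊆ [n] with |B_i| = k for all i. Then the number of permutations π of [n] satisfying π(i) ∉ B_i for all 1 ≤ i ≤ n is at most ((n−k)!)^{n/(n−k)}. -/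
open Finset
open scoped Classical

noncomputable section

def avP {n : ℕ} (S : Fin n → Finset (Fin n)) : Finset (Equiv.Perm (Fin n)) :=
  univ.filter fun π => ∀ i, π i ∈ S i

lemma mem_avP {n : ℕ} (S : Fin n → Finset (Fin n)) (π : Equiv.Perm (Fin n)) :
    π ∈ avP S ↔ ∀ i, π i ∈ S i := by
  simp [avP]

def avL (r : ℕ) : ℝ := Real.log (r.factorial : ℝ) / r

def avS {n : ℕ} (S : Fin n → Finset (Fin n)) (i k : Fin n) : Fin n → Finset (Fin n) :=
  fun j => if j = i then {k} else (S j).erase k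

lemma avP_avS {n : ℕ} (S : Fin n → Finset (Fin n)) (i k : Fin n) (hk : k ∈ S i) :
    avP (avS S i k) = (avP S).filter fun π => π i = k := by
  ext π
  simp only [mem_filter, mem_avP, avS]
  constructor
  · intro h
    have hi : π i = k := by simpa using h i
    refine ⟨fun j => ?_, hi⟩
    by_cases hj : j = i
    · subst hj; rw [hi]; exact hk
    · have := h j
      rw [if_neg hj] at this
      exact mem_of_mem_erase this
  · rintro ⟨h, hi⟩ j
    by_cases hj : j = i
    · subst hj; simp [hi]
    · rw [if_neg hj, mem_erase]
      refine ⟨fun e => hj (π.injective (e.trans hi.symm)), h j⟩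

lemma av_gibbs {n : ℕ} (S : Fin n → Finset (Fin n)) (i : Fin n) :
    ((avP S).card : ℝ) * Real.log (avP S).card ≤
      ∑ π ∈ avP S, (Real.log (S i).card + Real.log (avP (avS S i (π i))).card) := by
  rcases (avP S).eq_empty_or_nonempty with h0 | h0
  · simp [h0]
  have hN : (0 : ℝ) < (avP S).card := by exact_mod_cast h0.card_pos
  have hmem : ∀ π ∈ avP S, π i ∈ S i := fun π hπ => (mem_filter.1 hπ).2 i
  have hr : (0 : ℝ) < (S i).card := by
    obtain ⟨π, hπ⟩ := h0
    exact_mod_cast card_pos.2 ⟨_, hmem π hπ⟩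
  have hpos : ∀ π ∈ avP S, (0 : ℝ) < (avP (avS S i (π i))).card := by
    intro π hπ
    rw [avP_avS S i _ (hmem π hπ)]
    have : 0 < ((avP S).filter fun π' => π' i = π i).card :=
      card_pos.2 ⟨π, mem_filter.2 ⟨hπ, rfl⟩⟩
    exact_mod_cast this
  have key : ∑ π ∈ avP S, (1 / ((avP (avS S i (π i))).card : ℝ)) ≤ (S i).card := by
    rw [← sum_fiberwise_of_maps_to hmem]
    rw [card_eq_sum_ones, Nat.cast_sum]
    refine sum_le_sum fun k hk => ?_
    have : ∑ π ∈ avP S with π i = k, (1 / ((avP (avS S i (π i))).card : ℝ))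
        = ∑ π ∈ avP S with π i = k, (1 / ((avP (avS S i k)).card : ℝ)) := by
      refine sum_congr rfl fun π hπ => ?_
      rw [(mem_filter.1 hπ).2]
    rw [this, sum_const, avP_avS S i k hk, nsmul_eq_mul, mul_one_div]
    simpa using div_self_le_one _
  have h1 : ∑ π ∈ avP S, (Real.log (avP S).card -
      (Real.log (S i).card + Real.log (avP (avS S i (π i))).card)) ≤
      ∑ π ∈ avP S, (((avP S).card : ℝ) / (S i).card * (1 / ((avP (avS S i (π i))).card : ℝ)) - 1) := by
    refine sum_le_sum fun π hπ => ?_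
    have hp := hpos π hπ
    rw [← Real.log_mul hr.ne' hp.ne', ← Real.log_div hN.ne' (mul_pos hr hp).ne']
    refine (Real.log_le_sub_one_of_pos (by positivity)).trans (le_of_eq ?_)
    field_simp
  rw [sum_sub_distrib, sum_sub_distrib, ← mul_sum, sum_const, sum_const, nsmul_eq_mul,
    nsmul_eq_mul, mul_one] at h1
  have h2 := mul_le_mul_of_nonneg_left key (div_pos hN hr).le
  rw [div_mul_cancel₀ _ hr.ne'] at h2
  linarith

lemma av_inner {n : ℕ} (S : Fin n → Finset (Fin n)) (I : Finset (Fin n))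
    (hI : ∀ i, i ∉ I → ∃ k, S i = {k} ∧ ∀ j, j ≠ i → k ∉ S j)
    (π : Equiv.Perm (Fin n)) (hπ : π ∈ avP S) (j : Fin n) (hj : j ∈ I) :
    Real.log (S j).card + ∑ i ∈ I.erase j, avL ((S j).erase (π i)).card
      = I.card * avL (S j).card := by
  have hm : ∀ i, π i ∈ S i := (mem_filter.1 hπ).2
  have hc : ((I.erase j).filter fun i => π i ∈ S j).card = (S j).card - 1 := by
    rw [← card_erase_of_mem (hm j), ← card_map π.toEmbedding]
    congr 1
    ext b
    simp only [mem_map, mem_filter, mem_erase, Equiv.coe_toEmbedding]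
    constructor
    · rintro ⟨i, ⟨⟨h1, h2⟩, h3⟩, rfl⟩
      exact ⟨fun e => h1 (π.injective e), h3⟩
    · rintro ⟨h1, h2⟩
      refine ⟨π.symm b, ⟨⟨?_, ?_⟩, by simpa using h2⟩, by simp⟩
      · rintro rfl; simp at h1
      · by_contra hn
        obtain ⟨k, hk, hk'⟩ := hI _ hn
        have := hm (π.symm b)
        rw [hk] at this
        simp at this
        subst this
        refine hk' j ?_ h2
        rintro rfl; simp at h1
  have hpos : 0 < (S j).card := card_pos.2 ⟨_, hm j⟩
  have hIpos : 0 < I.card := card_pos.2 ⟨_, hj⟩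
  have hc2 := card_filter_add_card_filter_not (s := I.erase j) (fun i => π i ∈ S j)
  rw [hc, card_erase_of_mem hj] at hc2
  rw [← sum_filter_add_sum_filter_not (I.erase j) (fun i => π i ∈ S j)]
  have e1 : ∑ i ∈ I.erase j with π i ∈ S j, avL ((S j).erase (π i)).card
      = ((S j).card - 1 : ℕ) * avL ((S j).card - 1) := by
    rw [← hc, ← nsmul_eq_mul, ← sum_const, hc]
    refine sum_congr rfl fun i hi => ?_
    rw [card_erase_of_mem (mem_filter.1 hi).2]
  have e2 : ∑ i ∈ I.erase j with ¬ π i ∈ S j, avL ((S j).erase (π i)).card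
      = (((I.erase j).filter fun i => ¬ π i ∈ S j).card : ℝ) * avL (S j).card := by
    rw [← nsmul_eq_mul, ← sum_const]
    refine sum_congr rfl fun i hi => ?_
    rw [erase_eq_of_notMem (mem_filter.1 hi).2]
  rw [e1, e2]
  generalize ((I.erase j).filter fun i => ¬ π i ∈ S j).card = c at *
  obtain ⟨r, hr⟩ : ∃ r, (S j).card = r + 1 := ⟨_, (Nat.sub_add_cancel hpos).symm⟩
  rw [hr] at hc2 ⊢
  have hIc : I.card = r + 1 + c := by omega
  rw [hIc]
  have a1 : (r : ℝ) * avL r = Real.log r.factorial := by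
    unfold avL
    rcases Nat.eq_zero_or_pos r with rfl | h
    · simp
    · field_simp
  have a2 : ((r + 1 : ℕ) : ℝ) * avL (r + 1) = Real.log (r + 1 : ℕ) + Real.log r.factorial := by
    rw [← Real.log_mul (by positivity) (by positivity), ← Nat.cast_mul, ← Nat.factorial_succ]
    unfold avL
    field_simp
  simp only [Nat.add_sub_cancel]
  rw [a1]
  rw [Nat.cast_add (r + 1) c, add_mul, a2]
  ring

lemma av_main {n : ℕ} (m : ℕ) : ∀ (S : Fin n → Finset (Fin n)) (I : Finset (Fin n)),
    I.card = m → (∀ i, i ∉ I → ∃ k, S i = {k} ∧ ∀ j, j ≠ i → k ∉ S j) →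
    Real.log (avP S).card ≤ ∑ j ∈ I, avL (S j).card := by
  induction m with
  | zero =>
    intro S I hm hI
    rw [card_eq_zero] at hm
    subst hm
    have : (avP S).card ≤ 1 := by
      rw [card_le_one]
      intro a ha b hb
      ext i
      obtain ⟨k, hk, -⟩ := hI i (by simp)
      have h1 := (mem_filter.1 ha).2 i
      have h2 := (mem_filter.1 hb).2 i
      rw [hk, mem_singleton] at h1 h2
      rw [h1, h2]
    simp only [sum_empty]
    exact Real.log_nonpos (by positivity) (by exact_mod_cast this)
  | succ m ih =>
    intro S I hm hI
    rcases (avP S).eq_empty_or_nonempty with h0 | h0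
    · rw [h0]
      simp only [card_empty, Nat.cast_zero, Real.log_zero]
      exact sum_nonneg fun j _ => div_nonneg (Real.log_natCast_nonneg _) (by positivity)
    have hN : (0 : ℝ) < (avP S).card := by exact_mod_cast h0.card_pos
    have step : ∀ π ∈ avP S, ∀ i ∈ I, Real.log (avP (avS S i (π i))).card ≤
        ∑ j ∈ I.erase i, avL ((S j).erase (π i)).card := by
      intro π hπ i hi
      have hmm : ∀ i, π i ∈ S i := (mem_filter.1 hπ).2
      refine (ih (avS S i (π i)) (I.erase i) (by rw [card_erase_of_mem hi, hm]; rfl) ?_).trans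
        (le_of_eq ?_)
      · intro a ha
        by_cases hai : a = i
        · subst hai
          refine ⟨π a, by simp [avS], fun j hj => by simp [avS, hj]⟩
        · have ha' : a ∉ I := fun h => ha (mem_erase.2 ⟨hai, h⟩)
          obtain ⟨k, hk, hk'⟩ := hI a ha'
          have hki : k ≠ π i := fun e => hk' i (Ne.symm hai) (e ▸ hmm i)
          refine ⟨k, ?_, fun j hj => ?_⟩
          · simp only [avS, if_neg hai, hk]
            exact erase_eq_of_notMem (by simpa using hki.symm)
          · by_cases hji : j = i
            · simp [avS, hji, hki]
            · simp only [avS, if_neg hji, mem_erase]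
              exact fun h => hk' j hj h.2
      · refine sum_congr rfl fun j hj => ?_
        simp only [avS, if_neg (mem_erase.1 hj).1]
    have h1 : ∑ i ∈ I, ((avP S).card : ℝ) * Real.log (avP S).card ≤
        ∑ i ∈ I, ∑ π ∈ avP S, (Real.log (S i).card + Real.log (avP (avS S i (π i))).card) :=
      sum_le_sum fun i _ => av_gibbs S i
    rw [sum_comm, sum_const, nsmul_eq_mul] at h1
    have h2 : ∀ π ∈ avP S,
        ∑ i ∈ I, (Real.log (S i).card + Real.log (avP (avS S i (π i))).card) ≤
        I.card * ∑ j ∈ I, avL (S j).card := by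
      intro π hπ
      calc _ ≤ ∑ i ∈ I, (Real.log (S i).card + ∑ j ∈ I.erase i, avL ((S j).erase (π i)).card) :=
            sum_le_sum fun i hi => by linarith [step π hπ i hi]
        _ = ∑ j ∈ I, (Real.log (S j).card + ∑ i ∈ I.erase j, avL ((S j).erase (π i)).card) := by
            rw [sum_add_distrib, sum_add_distrib]
            congr 1
            refine sum_comm' fun x y => ?_
            simp only [mem_erase, ne_eq]
            tauto
        _ = _ := by
            rw [mul_sum]
            exact sum_congr rfl fun j hj => av_inner S I hI π hπ j hj
    have h3 := h1.trans (sum_le_sum h2)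
    rw [sum_const, nsmul_eq_mul, mul_left_comm] at h3
    have hIc : (0 : ℝ) < I.card := by rw [hm]; positivity
    exact le_of_mul_le_mul_left (le_of_mul_le_mul_left h3 hN) hIc

/-- **Claim (consequence of Brégman's bound).** Let `0 ≤ k < n` and let
`B_1,…,B_n ⊆ [n]` with `|B_i| = k` for all `i`.  Then the number of permutations `π`
of `[n]` with `π(i) ∉ B_i` for all `i` is at most `((n−k)!)^{n/(n−k)}`. -/
theorem count_avoiding_permutations (n k : ℕ) (hk : k < n)
    (B : Fin n → Finset (Fin n)) (hB : ∀ i, (B i).card = k) :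
    (((univ : Finset (Equiv.Perm (Fin n))).filter fun π =>
        ∀ i, π i ∉ B i).card : ℝ) ≤
      (((n - k).factorial : ℝ)) ^ ((n : ℝ) / ((n : ℝ) - (k : ℝ))) := by
  have hP : ((univ : Finset (Equiv.Perm (Fin n))).filter fun π => ∀ i, π i ∉ B i)
      = avP (fun i => (B i)ᶜ) := by
    ext π
    simp [avP]
  rw [hP]
  have hmain := av_main n (fun i => (B i)ᶜ) univ (by simp) (fun i hi => absurd (mem_univ i) hi)
  have hf : (0 : ℝ) < ((n - k).factorial : ℝ) := by positivity
  rcases (avP (fun i => (B i)ᶜ)).eq_empty_or_nonempty with h0 | h0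
  · rw [h0]
    simp only [card_empty, Nat.cast_zero]
    exact Real.rpow_nonneg hf.le _
  have hN : (0 : ℝ) < (avP (fun i => (B i)ᶜ)).card := by exact_mod_cast h0.card_pos
  rw [← Real.log_le_log_iff hN (Real.rpow_pos_of_pos hf _), Real.log_rpow hf]
  refine hmain.trans (le_of_eq ?_)
  simp only [card_compl, Fintype.card_fin, hB, sum_const, card_univ, nsmul_eq_mul, avL]
  rw [Nat.cast_sub hk.le]
  ring
end
end
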